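/- Let Γ be a finitely generated nonamenable group. Then there exists a finite generating family S of Γ (repetitions allowed) such that p_c(Cay(Γ, S)) < p_u(Cay(Γ, S)). -/

import Mathlib

open MeasureTheory Set BoundedContinuousFunction

noncomputable section

/-- A (discrete) group `G` is amenable if there is a left-invariant mean on `ℓ^∞(G)`:
a positive unital linear functional `φ` with `φ (g · f) = φ f`, where
`(g · f) h = f (g⁻¹ h)`. -/
def IsAmenable (G : Type*) [Group G] : Prop :=
  letI : TopologicalSpace G := ⊥
  haveI : DiscreteTopology G := ⟨rfl⟩
  ∃ φ : (G →ᵇ ℝ) →ₗ[ℝ] ℝ,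
    (∀ f : G →ᵇ ℝ, (∀ x, 0 ≤ f x) → 0 ≤ φ f) ∧
    φ 1 = 1 ∧
    ∀ (g : G) (f : G →ᵇ ℝ),
      φ (f.compContinuous ⟨fun h => g⁻¹ * h, continuous_of_discreteTopology⟩) = φ f

variable {Γ : Type} [Group Γ] {d : ℕ}

/-- The edge `(g, i)` of the Cayley graph `Cay(Γ, S)` joins `g` and `g * S i`. -/
def Joins (S : Fin d → Γ) (e : Γ × Fin d) (u v : Γ) : Prop :=
  (u = e.1 ∧ v = e.1 * S e.2) ∨ (v = e.1 ∧ u = e.1 * S e.2)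

/-- `u` and `v` are connected by a path of `ω`-open edges. -/
def OpenConn (S : Fin d → Γ) (ω : Γ × Fin d → Bool) (u v : Γ) : Prop :=
  Relation.ReflTransGen (fun a b => ∃ e, ω e = true ∧ Joins S e a b) u v

/-- The cluster of `v` in `ω`. -/
def Cluster (S : Fin d → Γ) (ω : Γ × Fin d → Bool) (v : Γ) : Set Γ :=
  {u | OpenConn S ω v u}

/-- `P` is Bernoulli(`p`) bond percolation on `Cay(Γ, S)`. -/
def IsBernoulli (S : Fin d → Γ) (p : ℝ) (P : Measure (Γ × Fin d → Bool)) : Prop :=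
  IsProbabilityMeasure P ∧
    ∀ (s : Finset (Γ × Fin d)) (f : Γ × Fin d → Bool),
      P {ω | ∀ e ∈ s, ω e = f e} = ∏ e ∈ s, ENNReal.ofReal (if f e then p else 1 - p)

/-- The event that there is an infinite cluster. -/
def PercEvent (S : Fin d → Γ) : Set (Γ × Fin d → Bool) :=
  {ω | ∃ v, (Cluster S ω v).Infinite}

/-- The critical probability `p_c(Cay(Γ, S))`. -/
def pc (S : Fin d → Γ) : ℝ :=
  sInf {p | p ∈ Icc (0:ℝ) 1 ∧
    ∀ P : Measure (Γ × Fin d → Bool), IsBernoulli S p P → P (PercEvent S) = 1}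

/-- `C` is an infinite cluster of `ω`. -/
def IsInfCluster (S : Fin d → Γ) (ω : Γ × Fin d → Bool) (C : Set Γ) : Prop :=
  (∃ v, C = Cluster S ω v) ∧ C.Infinite

/-- The event that there is exactly one infinite cluster. -/
def UniqueEvent (S : Fin d → Γ) : Set (Γ × Fin d → Bool) :=
  {ω | ∃! C : Set Γ, IsInfCluster S ω C}

/-- The uniqueness threshold `p_u(Cay(Γ, S))`. -/
def pu (S : Fin d → Γ) : ℝ :=
  sInf {p | p ∈ Icc (0:ℝ) 1 ∧
    ∀ P : Measure (Γ × Fin d → Bool), IsBernoulli S p P → P (UniqueEvent S) = 1}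

/-- The Hilbert space `ℓ²(Γ)`. -/
abbrev SquareSummable (X : Type) := lp (fun _ : X => ℝ) 2

lemma hasSum_sq {X : Type} (f : SquareSummable X) :
    HasSum (fun g => f g ^ 2) (‖f‖ ^ 2) := by
  simpa [sq, real_inner_self_eq_norm_sq] using lp.hasSum_inner (𝕜 := ℝ) f f

lemma memℓp_two_of_summable_sq {X : Type} {f : X → ℝ} (hf : Summable fun g => f g ^ 2) :
    Memℓp f 2 := by
  apply memℓp_gen
  simpa using hf

lemma memℓp_rightTranslate (s : Γ) (f : SquareSummable Γ) :
    Memℓp (fun g => f (g * s)) 2 :=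
  memℓp_two_of_summable_sq <| (Equiv.mulRight s).summable_iff.2 (hasSum_sq f).summable

/-- Right translation of a square summable function. -/
def rightTranslate (s : Γ) (f : SquareSummable Γ) : SquareSummable Γ :=
  ⟨fun g => f (g * s), memℓp_rightTranslate s f⟩

lemma norm_rightTranslate (s : Γ) (f : SquareSummable Γ) : ‖rightTranslate s f‖ = ‖f‖ := by
  refine (pow_left_inj₀ (norm_nonneg _) (norm_nonneg _) two_ne_zero).1 ?_
  exact (hasSum_sq (rightTranslate s f)).unique ((Equiv.mulRight s).hasSum_iff.2 (hasSum_sq f))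

/-- The right regular representation on `ℓ²(Γ)`: `(rightReg s f) g = f (g * s)`. -/
def rightReg (s : Γ) : SquareSummable Γ →ₗᵢ[ℝ] SquareSummable Γ where
  toFun := rightTranslate s
  map_add' _ _ := rfl
  map_smul' _ _ := rfl
  norm_map' := norm_rightTranslate s

@[simp] lemma rightReg_apply (s : Γ) (f : SquareSummable Γ) (g : Γ) :
    rightReg s f g = f (g * s) := rfl

@[simp] lemma rightReg_one (f : SquareSummable Γ) : rightReg 1 f = f := by
  ext g; simp

lemma rightReg_mul (s t : Γ) (f : SquareSummable Γ) :
    rightReg (s * t) f = rightReg s (rightReg t f) := by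
  ext g; simp [mul_assoc]

lemma inner_rightReg_inv (s : Γ) (f g : SquareSummable Γ) :
    inner ℝ (rightReg s⁻¹ f) g = inner ℝ f (rightReg s g) := by
  rw [← (rightReg s).inner_map_map, ← rightReg_mul]
  simp

lemma abs_apply_le_norm {X : Type} (f : SquareSummable X) (g : X) : |f g| ≤ ‖f‖ :=
  lp.norm_apply_le_norm two_ne_zero f g

/-- The sum of the translations by a finite family has norm at most `r` on `ℓ²(Γ)`. -/
def NormSumLE {ι : Type} [Fintype ι] (T : ι → Γ) (r : ℝ) : Prop :=
  ∀ f : SquareSummable Γ, ‖∑ i, rightReg (T i) f‖ ≤ r * ‖f‖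

lemma NormSumLE.inv {ι : Type} [Fintype ι] {T : ι → Γ} {r : ℝ} (h : NormSumLE T r) :
    NormSumLE (fun i => (T i)⁻¹) r := by
  intro f
  set x := ∑ i, rightReg (T i)⁻¹ f with hx
  have h1 : ‖x‖ * ‖x‖ ≤ (r * ‖f‖) * ‖x‖ := by
    calc ‖x‖ * ‖x‖ = inner ℝ x x := (real_inner_self_eq_norm_mul_norm x).symm
      _ = inner ℝ f (∑ i, rightReg (T i) x) := by
        conv_lhs => enter [2]; rw [hx]
        simp only [sum_inner, inner_sum, inner_rightReg_inv]
      _ ≤ ‖f‖ * ‖∑ i, rightReg (T i) x‖ := real_inner_le_norm _ _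
      _ ≤ ‖f‖ * (r * ‖x‖) := by gcongr; exact h x
      _ = _ := by ring
  rcases (norm_nonneg x).eq_or_lt with h0 | h0
  · rw [← h0]
    exact (norm_nonneg _).trans (h f)
  · exact le_of_mul_le_mul_right h1 h0

lemma NormSumLE.mul {ι κ : Type} [Fintype ι] [Fintype κ] {T : ι → Γ} {U : κ → Γ} {r q : ℝ}
    (hr : 0 ≤ r) (hT : NormSumLE T r) (hU : NormSumLE U q) :
    NormSumLE (fun x : ι × κ => T x.1 * U x.2) (r * q) := by
  intro f
  have : ∑ x : ι × κ, rightReg (T x.1 * U x.2) f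
      = ∑ i, rightReg (T i) (∑ j, rightReg (U j) f) := by
    simp only [Fintype.sum_prod_type, rightReg_mul, map_sum]
  rw [this, mul_assoc]
  exact (hT _).trans (mul_le_mul_of_nonneg_left (hU f) hr)

lemma summable_mul_sq (f : SquareSummable Γ) {h : Γ → ℝ} {C : ℝ} (hC : ∀ g, |h g| ≤ C) :
    Summable fun g => h g⁻¹ * f g ^ 2 := by
  refine Summable.of_norm_bounded ((hasSum_sq f).summable.mul_left C) fun g => ?_
  rw [norm_mul, Real.norm_eq_abs, Real.norm_eq_abs, abs_sq]
  gcongr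
  exact hC _

lemma tsum_translate_sub_le (f : SquareSummable Γ) {h : Γ → ℝ} {C : ℝ}
    (hC : ∀ g, |h g| ≤ C) (hf : ‖f‖ = 1) {δ : ℝ} (hδ : 0 < δ) (t : Γ)
    (ht : ‖rightReg t⁻¹ f - f‖ ≤ δ) :
    |(∑' g, h (t⁻¹ * g⁻¹) * f g ^ 2) - ∑' g, h g⁻¹ * f g ^ 2| ≤ C * (3 * δ) := by
  have hC0 : 0 ≤ C := (abs_nonneg _).trans (hC 1)
  set x := rightReg t⁻¹ f - f with hx
  set y := rightReg t⁻¹ f + f with hy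
  have hyn : ‖y‖ ≤ 2 := by
    calc ‖y‖ ≤ ‖rightReg t⁻¹ f‖ + ‖f‖ := norm_add_le _ _
      _ = 2 := by rw [LinearIsometry.norm_map, hf]; norm_num
  have e1 : ∑' g, h (t⁻¹ * g⁻¹) * f g ^ 2 = ∑' g, h g⁻¹ * (rightReg t⁻¹ f) g ^ 2 := by
    rw [← (Equiv.mulRight t⁻¹).tsum_eq]
    exact tsum_congr fun g => by simp
  rw [e1, ← (summable_mul_sq _ hC).tsum_sub (summable_mul_sq _ hC)]
  have hb : HasSum (fun g => C * (1 / (2 * δ) * x g ^ 2 + δ / 2 * y g ^ 2))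
      (C * (1 / (2 * δ) * ‖x‖ ^ 2 + δ / 2 * ‖y‖ ^ 2)) :=
    (((hasSum_sq x).mul_left _).add ((hasSum_sq y).mul_left _)).mul_left _
  rw [← Real.norm_eq_abs]
  refine (tsum_of_norm_bounded hb fun g => ?_).trans ?_
  · have : h g⁻¹ * (rightReg t⁻¹ f) g ^ 2 - h g⁻¹ * f g ^ 2 = h g⁻¹ * (x g * y g) := by
      simp only [hx, hy, lp.coeFn_sub, lp.coeFn_add, Pi.sub_apply, Pi.add_apply]; ring
    rw [this, norm_mul, Real.norm_eq_abs, Real.norm_eq_abs]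
    refine mul_le_mul (hC _) ?_ (abs_nonneg _) hC0
    have key : ∀ a b : ℝ, a * b ≤ 1 / (2 * δ) * a ^ 2 + δ / 2 * b ^ 2 := fun a b => by
      have : 1 / (2 * δ) * a ^ 2 + δ / 2 * b ^ 2 - a * b = (a - δ * b) ^ 2 / (2 * δ) := by
        field_simp; ring
      have : 0 ≤ (a - δ * b) ^ 2 / (2 * δ) := by positivity
      linarith
    rw [abs_le]
    exact ⟨by have := key (-(x g)) (y g); nlinarith, key _ _⟩
  · gcongr
    have h1 : ‖x‖ ^ 2 ≤ δ ^ 2 := by gcongr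
    have h2 : ‖y‖ ^ 2 ≤ 2 ^ 2 := by gcongr
    calc 1 / (2 * δ) * ‖x‖ ^ 2 + δ / 2 * ‖y‖ ^ 2
        ≤ 1 / (2 * δ) * δ ^ 2 + δ / 2 * 2 ^ 2 := by gcongr
      _ ≤ 3 * δ := by field_simp; nlinarith

/-- A group with almost invariant vectors in `ℓ²` is amenable. -/
lemma isAmenable_of_almost_invariant
    (h : ∀ (F : Finset Γ) (ε : ℝ), 0 < ε →
      ∃ f : SquareSummable Γ, ∀ t ∈ F, ‖rightReg t f - f‖ < ε * ‖f‖) :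
    IsAmenable Γ := by
  classical
  let _ : TopologicalSpace Γ := ⊥
  have : DiscreteTopology Γ := ⟨rfl⟩
  have hunit : ∀ j : Finset Γ × ℕ, ∃ f : SquareSummable Γ, ‖f‖ = 1 ∧
      ∀ t ∈ j.1, ‖rightReg t f - f‖ ≤ 1 / ((j.2 : ℝ) + 1) := by
    rintro ⟨F, n⟩
    obtain ⟨f, hf⟩ := h (insert 1 F) (1 / ((n : ℝ) + 1)) (by positivity)
    have hf0 : 0 < ‖f‖ := by
      by_contra hcon
      have h0 : ‖f‖ = 0 := le_antisymm (not_lt.1 hcon) (norm_nonneg _)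
      have := hf 1 (Finset.mem_insert_self _ _)
      rw [h0, mul_zero] at this
      exact absurd this (not_lt.2 (norm_nonneg _))
    refine ⟨‖f‖⁻¹ • f, ?_, fun t ht => ?_⟩
    · rw [norm_smul, norm_inv, norm_norm, inv_mul_cancel₀ hf0.ne']
    · rw [map_smul, ← smul_sub, norm_smul, norm_inv, norm_norm, inv_mul_le_iff₀ hf0, mul_comm]
      exact (hf t (Finset.mem_insert_of_mem ht)).le
  choose v hv1 hv2 using hunit
  let U : Ultrafilter (Finset Γ × ℕ) := Ultrafilter.of Filter.atTop
  have hU : (U : Filter _) ≤ (Filter.atTop : Filter (Finset Γ × ℕ)) := Ultrafilter.of_le _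
  have hbd : ∀ (f : Γ →ᵇ ℝ) (g : Γ), |f g| ≤ ‖f‖ := fun f g => f.norm_coe_le_norm g
  have hsum : ∀ (f : Γ →ᵇ ℝ) j, Summable fun g => f g⁻¹ * v j g ^ 2 :=
    fun f j => summable_mul_sq _ (hbd f)
  have hlim : ∀ f : Γ →ᵇ ℝ, ∃ x,
      Filter.Tendsto (fun j => ∑' g, f g⁻¹ * v j g ^ 2) U (nhds x) := by
    intro f
    have hmem : ∀ j, (∑' g, f g⁻¹ * v j g ^ 2) ∈ Metric.closedBall (0 : ℝ) ‖f‖ := by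
      intro j
      rw [mem_closedBall_zero_iff]
      have := tsum_of_norm_bounded ((hasSum_sq (v j)).mul_left ‖f‖)
        (f := fun g => f g⁻¹ * v j g ^ 2) (fun g => by
          rw [norm_mul, Real.norm_eq_abs, Real.norm_eq_abs, abs_sq]
          gcongr
          exact hbd f _)
      simpa [hv1] using this
    obtain ⟨x, -, hx⟩ := (isCompact_closedBall (0 : ℝ) ‖f‖).ultrafilter_le_nhds
      (U.map fun j => ∑' g, f g⁻¹ * v j g ^ 2)
      (by
        rw [Filter.le_principal_iff]
        exact Filter.mem_map.2 (Filter.univ_mem' hmem))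
    exact ⟨x, hx⟩
  choose φ hφ using hlim
  refine ⟨{ toFun := φ, map_add' := fun f g => ?_, map_smul' := fun c f => ?_ }, ?_, ?_, ?_⟩
  · refine tendsto_nhds_unique (hφ (f + g)) (((hφ f).add (hφ g)).congr fun j => ?_)
    rw [← (hsum f j).tsum_add (hsum g j)]
    exact tsum_congr fun x => by simp [add_mul]
  · refine tendsto_nhds_unique (hφ (c • f)) (((hφ f).const_mul c).congr fun j => ?_)
    rw [← tsum_mul_left]
    exact tsum_congr fun x => by simp [mul_assoc]
  · intro f hf
    exact ge_of_tendsto' (hφ f) fun j =>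
      tsum_nonneg fun g => mul_nonneg (hf _) (sq_nonneg _)
  · refine tendsto_nhds_unique (hφ 1) (tendsto_const_nhds.congr fun j => ?_)
    have := (hasSum_sq (v j)).tsum_eq
    rw [hv1] at this
    simpa using this.symm
  · intro t f
    refine tendsto_nhds_unique (hφ _) ?_
    have hsub : Filter.Tendsto (fun j : Finset Γ × ℕ =>
        (∑' g, f (t⁻¹ * g⁻¹) * v j g ^ 2) - ∑' g, f g⁻¹ * v j g ^ 2) U (nhds 0) := by
      have h0 : Filter.Tendsto (fun j : Finset Γ × ℕ => ‖f‖ * (3 * (1 / ((j.2 : ℝ) + 1)))) U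
          (nhds 0) := by
        have h1 : Filter.Tendsto (fun j : Finset Γ × ℕ => (1 / ((j.2 : ℝ) + 1)))
            Filter.atTop (nhds 0) := by
          rw [← Filter.prod_atTop_atTop_eq]
          exact tendsto_one_div_add_atTop_nhds_zero_nat.comp Filter.tendsto_snd
        simpa using ((h1.const_mul 3).const_mul ‖f‖).mono_left hU
      refine squeeze_zero_norm' ?_ h0
      have hev : ∀ᶠ j : Finset Γ × ℕ in U, {t⁻¹} ≤ j.1 := by
        refine hU ?_
        filter_upwards [Filter.eventually_ge_atTop (({t⁻¹} : Finset Γ), 0)] with j hj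
        exact hj.1
      filter_upwards [hev] with j hj
      exact tsum_translate_sub_le _ (hbd f) (hv1 j) (by positivity) t
        (hv2 j _ (Finset.singleton_subset_iff.1 hj))
    simpa using hsub.add (hφ f)

lemma exists_spectral_gap (hna : ¬ IsAmenable Γ) :
    ∃ (F : Finset Γ) (c : ℝ), 0 ≤ c ∧ c < 2 ∧
      ∀ f : SquareSummable Γ, ∃ t ∈ F, ‖f + rightReg t f‖ ≤ c * ‖f‖ := by
  have h := mt isAmenable_of_almost_invariant hna
  push Not at h
  obtain ⟨F, ε', hε', h⟩ := h
  set ε := min ε' 1 with hε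
  have hε0 : 0 < ε := lt_min hε' one_pos
  have hε1 : ε ≤ 1 := min_le_right _ _
  refine ⟨F, 2 - ε ^ 2 / 4, by nlinarith, by nlinarith, fun f => ?_⟩
  obtain ⟨t, ht, hf⟩ := h f
  refine ⟨t, ht, ?_⟩
  have h1 : ε * ‖f‖ ≤ ‖f - rightReg t f‖ := by
    rw [norm_sub_rev]
    exact (mul_le_mul_of_nonneg_right (min_le_left _ _) (norm_nonneg _)).trans hf
  have h2 := parallelogram_law_with_norm ℝ f (rightReg t f)
  rw [LinearIsometry.norm_map] at h2
  have h3 : (ε * ‖f‖) ^ 2 ≤ ‖f - rightReg t f‖ ^ 2 := by gcongr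
  refine (pow_le_pow_iff_left₀ (norm_nonneg _)
    (mul_nonneg (by nlinarith) (norm_nonneg _)) two_ne_zero).1 ?_
  have h4 : 0 ≤ (ε ^ 2 / 4 * ‖f‖) ^ 2 := sq_nonneg _
  linarith only [h2, h3, h4]

lemma exists_normSumLE_lt (hfg : ∃ (n : ℕ) (T : Fin n → Γ), Subgroup.closure (Set.range T) = ⊤)
    (hna : ¬ IsAmenable Γ) :
    ∃ (ι : Type) (_ : Fintype ι) (T : ι → Γ) (r : ℝ), 1 ∈ Set.range T ∧
      Subgroup.closure (Set.range T) = ⊤ ∧ NormSumLE T r ∧ 0 ≤ r ∧ r < Fintype.card ι ∧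
      2 ≤ Fintype.card ι := by
  classical
  obtain ⟨n, T₀, hT₀⟩ := hfg
  obtain ⟨F, c, hc0, hc, hF⟩ := exists_spectral_gap hna
  let T : Unit ⊕ (F ⊕ Fin n) → Γ := Sum.elim (fun _ => 1) (Sum.elim (fun t => t.1) T₀)
  have hF1 : 1 ≤ F.card := by
    obtain ⟨t, ht, -⟩ := hF 0
    exact Finset.card_pos.2 ⟨t, ht⟩
  have hcard : Fintype.card (Unit ⊕ (F ⊕ Fin n)) = 1 + (F.card + n) := by simp
  have hF1' : (1 : ℝ) ≤ F.card := by exact_mod_cast hF1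
  refine ⟨Unit ⊕ (F ⊕ Fin n), inferInstance, T, c + (F.card - 1) + n, ⟨Sum.inl (), rfl⟩, ?_, ?_,
    by positivity [sub_nonneg.2 hF1'], ?_, by omega⟩
  · refine eq_top_iff.2 (hT₀ ▸ Subgroup.closure_mono ?_)
    rintro _ ⟨i, rfl⟩
    exact ⟨Sum.inr (Sum.inr i), rfl⟩
  · intro f
    obtain ⟨t, ht, hft⟩ := hF f
    have hs : ∑ i, rightReg (T i) f = (f + rightReg t f)
        + ∑ s ∈ F.erase t, rightReg s f + ∑ i, rightReg (T₀ i) f := by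
      rw [add_assoc f, Finset.add_sum_erase F (fun s => rightReg s f) ht]
      simp only [T, Fintype.sum_sum_type, Sum.elim_inl, Sum.elim_inr, Finset.univ_unique,
        Finset.sum_singleton, rightReg_one, Finset.univ_eq_attach, add_assoc]
      rw [Finset.sum_attach F (fun s => rightReg s f)]
    rw [hs]
    have h1 : ‖∑ s ∈ F.erase t, rightReg s f‖ ≤ (F.card - 1) * ‖f‖ := by
      refine (norm_sum_le _ _).trans_eq ?_
      simp [Finset.card_erase_of_mem ht, Nat.cast_sub hF1]
    have h2 : ‖∑ i, rightReg (T₀ i) f‖ ≤ n * ‖f‖ := by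
      refine (norm_sum_le _ _).trans_eq ?_
      simp
    calc _ ≤ _ := norm_add₃_le
      _ ≤ c * ‖f‖ + (F.card - 1) * ‖f‖ + n * ‖f‖ := by gcongr
      _ = _ := by ring
  · rw [hcard]
    push_cast
    linarith

lemma exists_normSumLE_pow {ι : Type} [Fintype ι] {T : ι → Γ} {r : ℝ} (h1 : 1 ∈ Set.range T)
    (hT : Subgroup.closure (Set.range T) = ⊤) (hr : 0 ≤ r) (h : NormSumLE T r) (N : ℕ) :
    ∃ (κ : Type) (_ : Fintype κ) (U : κ → Γ), 1 ∈ Set.range U ∧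
      Subgroup.closure (Set.range U) = ⊤ ∧ NormSumLE U (r ^ (N + 1)) ∧
      Fintype.card κ = Fintype.card ι ^ (N + 1) := by
  induction N with
  | zero => exact ⟨ι, inferInstance, T, h1, hT, by simpa using h, by simp⟩
  | succ N ih =>
    obtain ⟨κ, _, U, ⟨j, hj⟩, hU, hUr, hcard⟩ := ih
    obtain ⟨i, hi⟩ := h1
    refine ⟨κ × ι, inferInstance, fun x => U x.1 * T x.2, ⟨(j, i), by simp [hi, hj]⟩, ?_,
      hUr.mul (pow_nonneg hr _) h, by simp [hcard, pow_succ]⟩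
    refine eq_top_iff.2 (hU ▸ Subgroup.closure_mono ?_)
    rintro _ ⟨k, rfl⟩
    exact ⟨(k, i), by simp [hi]⟩

/-- A finitely generated nonamenable group has a generating family whose normalized
convolution operator has arbitrarily small norm. -/
lemma exists_generating_family_normSumLE
    (hfg : ∃ (n : ℕ) (T : Fin n → Γ), Subgroup.closure (Set.range T) = ⊤)
    (hna : ¬ IsAmenable Γ) {ε : ℝ} (hε : 0 < ε) (M : ℕ) :
    ∃ (d : ℕ) (S : Fin d → Γ) (q : ℝ), Subgroup.closure (Set.range S) = ⊤ ∧ NormSumLE S q ∧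
      0 ≤ q ∧ q ≤ ε * d ∧ M ≤ d := by
  obtain ⟨ι, _, T, r, h1, hT, hTr, hr, hrm, hm⟩ := exists_normSumLE_lt hfg hna
  set m := Fintype.card ι
  have hm0 : (0 : ℝ) < m := by exact_mod_cast (two_pos.trans_le hm)
  have hlim := tendsto_pow_atTop_nhds_zero_of_lt_one (r := r / m) (div_nonneg hr hm0.le)
    ((div_lt_one hm0).2 hrm)
  obtain ⟨N, hN, hNM⟩ := ((hlim.eventually_le_const hε).and (Filter.eventually_ge_atTop M)).exists
  obtain ⟨κ, _, U, -, hU, hUr, hcard⟩ := exists_normSumLE_pow h1 hT hr hTr N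
  let e := Fintype.equivFin κ
  refine ⟨Fintype.card κ, U ∘ e.symm, r ^ (N + 1), ?_, fun f => ?_, by positivity, ?_, ?_⟩
  · rwa [e.symm.surjective.range_comp]
  · have := e.symm.sum_comp fun k => rightReg (U k) f
    simpa only [Function.comp_apply, this] using hUr f
  · rw [div_pow, div_le_iff₀ (by positivity)] at hN
    rw [hcard]
    push_cast
    rw [pow_succ, pow_succ, ← mul_assoc]
    gcongr
  · rw [hcard]
    calc M ≤ N := hNM
      _ ≤ 2 ^ (N + 1) := by
        have := Nat.lt_two_pow_self (n := N + 1)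
        omega
      _ ≤ m ^ (N + 1) := by gcongr

section Cylinder

variable {V : Type}

/-- The cylinder event prescribing the states of the edges in `s`. -/
def edgeCylinder (s : Finset (V × Fin d)) (f : V × Fin d → Bool) : Set (V × Fin d → Bool) :=
  {ω | ∀ e ∈ s, ω e = f e}

lemma measurableSet_edge (e : V × Fin d) (b : Bool) :
    MeasurableSet {ω : V × Fin d → Bool | ω e = b} :=
  measurable_pi_apply (X := fun _ : V × Fin d => Bool) e (measurableSet_singleton b)

lemma measurableSet_edgeCylinder (s : Finset (V × Fin d)) (f : V × Fin d → Bool) :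
    MeasurableSet (edgeCylinder s f) := by
  have : edgeCylinder s f = ⋂ e ∈ s, {ω | ω e = f e} := by
    ext; simp [edgeCylinder]
  rw [this]
  exact Finset.measurableSet_biInter _ fun e _ => measurableSet_edge e _

lemma isPiSystem_edgeCylinder :
    IsPiSystem {A : Set (V × Fin d → Bool) | ∃ s f, A = edgeCylinder s f} := by
  classical
  rintro _ ⟨s, f, rfl⟩ _ ⟨s', f', rfl⟩ ⟨ω₀, h, h'⟩
  refine ⟨s ∪ s', ω₀, ?_⟩
  ext ω
  simp only [edgeCylinder, mem_inter_iff, mem_ofPred_eq, Finset.mem_union] at h h' ⊢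
  constructor
  · rintro ⟨h1, h2⟩ e (he | he)
    · rw [h1 e he, h e he]
    · rw [h2 e he, h' e he]
  · intro h1
    exact ⟨fun e he => by rw [h1 e (Or.inl he), h e he],
      fun e he => by rw [h1 e (Or.inr he), h' e he]⟩

lemma generateFrom_edgeCylinder :
    (MeasurableSpace.pi : MeasurableSpace (V × Fin d → Bool)) =
      MeasurableSpace.generateFrom {A | ∃ s f, A = edgeCylinder s f} := by
  apply le_antisymm
  · refine iSup_le fun e => ?_
    rintro _ ⟨B, -, rfl⟩
    have : (fun ω : V × Fin d → Bool => ω e) ⁻¹' B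
        = ⋃ b ∈ B, edgeCylinder {e} (fun _ => b) := by
      ext ω; simp [edgeCylinder]
    rw [this]
    refine @MeasurableSet.biUnion _ _ (MeasurableSpace.generateFrom _) _ _ B.to_countable
      fun b _ => ?_
    exact MeasurableSpace.measurableSet_generateFrom ⟨_, _, rfl⟩
  · refine MeasurableSpace.generateFrom_le ?_
    rintro _ ⟨s, f, rfl⟩
    exact measurableSet_edgeCylinder s f

end Cylinder

namespace IsBernoulli

variable {V : Type} {S : Fin d → V} {p : ℝ} {P P' : Measure (V × Fin d → Bool)}

lemma unique (h : IsBernoulli S p P) (h' : IsBernoulli S p P') : P = P' := by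
  have := h.1
  have := h'.1
  refine ext_of_generate_finite _ generateFrom_edgeCylinder isPiSystem_edgeCylinder ?_ (by simp)
  rintro _ ⟨s, f, rfl⟩
  exact (h.2 s f).trans (h'.2 s f).symm

lemma exists_of_mem_Icc (S : Fin d → V) (hp : p ∈ Icc (0 : ℝ) 1) :
    ∃ P : Measure (V × Fin d → Bool), IsBernoulli S p P := by
  let ν : Measure Bool := ENNReal.ofReal p • Measure.dirac true
    + ENNReal.ofReal (1 - p) • Measure.dirac false
  have : IsProbabilityMeasure ν := ⟨by
    simp only [ν, Measure.coe_add, Measure.coe_smul, Pi.add_apply, Pi.smul_apply, measure_univ,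
      smul_eq_mul, mul_one]
    rw [← ENNReal.ofReal_add hp.1 (by linarith [hp.2])]
    simp⟩
  refine ⟨Measure.infinitePi fun _ => ν, inferInstance, fun s f => ?_⟩
  have : {ω : V × Fin d → Bool | ∀ e ∈ s, ω e = f e} = Set.pi s fun e => {f e} := by
    ext; simp
  rw [this, Measure.infinitePi_pi _ fun _ _ => measurableSet_singleton _]
  refine Finset.prod_congr rfl fun e _ => ?_
  cases f e <;> simp [ν]

/-- Conditioning a Bernoulli percolation on the state of one edge. -/
lemma measure_eq_update [DecidableEq (V × Fin d)] (h : IsBernoulli S p P)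
    (hp : p ∈ Icc (0 : ℝ) 1) (e : V × Fin d) {A : Set (V × Fin d → Bool)}
    (hA : MeasurableSet A) :
    P A = ENNReal.ofReal p * P {ω | Function.update ω e true ∈ A}
      + ENNReal.ofReal (1 - p) * P {ω | Function.update ω e false ∈ A} := by
  have := h.1
  have hmeas : ∀ b : Bool, Measurable fun ω : V × Fin d → Bool => Function.update ω e b :=
    fun b => measurable_pi_lambda _ fun x => by
      by_cases hx : x = e
      · subst hx; simp
      · simpa [Function.update_of_ne hx] using measurable_pi_apply x
  let P' := ENNReal.ofReal p • P.map (fun ω => Function.update ω e true)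
    + ENNReal.ofReal (1 - p) • P.map fun ω => Function.update ω e false
  have hP' : ∀ B, MeasurableSet B → P' B =
      ENNReal.ofReal p * P {ω | Function.update ω e true ∈ B}
      + ENNReal.ofReal (1 - p) * P {ω | Function.update ω e false ∈ B} := by
    intro B hB
    simp only [P', Measure.coe_add, Measure.coe_smul, Pi.add_apply, Pi.smul_apply, smul_eq_mul]
    rw [Measure.map_apply (hmeas _) hB, Measure.map_apply (hmeas _) hB]
    rfl
  have hpp : ENNReal.ofReal p + ENNReal.ofReal (1 - p) = 1 := by
    rw [← ENNReal.ofReal_add hp.1 (by linarith [hp.2])]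
    simp
  have hB : IsBernoulli S p P' := by
    refine ⟨⟨?_⟩, fun s f => ?_⟩
    · rw [hP' _ MeasurableSet.univ]
      simpa using hpp
    · have hm := hP' _ (measurableSet_edgeCylinder s f)
      rw [edgeCylinder] at hm
      rw [hm]
      by_cases he : e ∈ s
      · have key : ∀ b : Bool, P {ω | Function.update ω e b ∈ {ω | ∀ e ∈ s, ω e = f e}} =
            if b = f e then ∏ x ∈ s.erase e, ENNReal.ofReal (if f x then p else 1 - p) else 0 := by
          intro b
          split_ifs with hb
          · rw [← h.2]
            congr 1
            ext ω
            simp only [mem_ofPred_eq, Finset.mem_erase]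
            constructor
            · rintro hω x ⟨hx, hxs⟩
              rw [← hω x hxs, Function.update_of_ne hx]
            · intro hω x hxs
              by_cases hx : x = e
              · subst hx; simpa using hb
              · rw [Function.update_of_ne hx, hω x ⟨hx, hxs⟩]
          · rw [← measure_empty (μ := P)]
            congr 1
            ext ω
            simp only [mem_ofPred_eq, mem_empty_iff_false, iff_false]
            intro hω
            exact hb (by simpa using hω e he)
        rw [key, key, ← Finset.mul_prod_erase s _ he]
        cases f e <;> simp
      · have key : ∀ b : Bool, P {ω | Function.update ω e b ∈ {ω | ∀ e ∈ s, ω e = f e}} =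
            ∏ x ∈ s, ENNReal.ofReal (if f x then p else 1 - p) := by
          intro b
          rw [← h.2]
          congr 1
          ext ω
          refine forall₂_congr fun x hx => ?_
          rw [Function.update_of_ne (by rintro rfl; exact he hx)]
        rw [key, key, ← add_mul, hpp, one_mul]
  rw [← hP' A hA, h.unique hB]

lemma measureReal_eq_update [DecidableEq (V × Fin d)] (h : IsBernoulli S p P)
    (hp : p ∈ Icc (0 : ℝ) 1) (e : V × Fin d) {A : Set (V × Fin d → Bool)}
    (hA : MeasurableSet A) :
    P.real A = p * P.real {ω | Function.update ω e true ∈ A}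
      + (1 - p) * P.real {ω | Function.update ω e false ∈ A} := by
  have := h.1
  simp only [measureReal_def]
  rw [h.measure_eq_update hp e hA, ENNReal.toReal_add (by finiteness) (by finiteness),
    ENNReal.toReal_mul, ENNReal.toReal_mul, ENNReal.toReal_ofReal hp.1,
    ENNReal.toReal_ofReal (by linarith [hp.2])]

/-- Bernoulli percolation is invariant under left translations. -/
lemma map_translate {S : Fin d → Γ} {P : Measure (Γ × Fin d → Bool)} (h : IsBernoulli S p P)
    (g : Γ) :
    P.map (fun ω e => ω (g * e.1, e.2)) = P := by
  classical
  have := h.1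
  have hmeas : Measurable fun (ω : Γ × Fin d → Bool) (e : Γ × Fin d) => ω (g * e.1, e.2) :=
    measurable_pi_lambda _ fun e => measurable_pi_apply _
  refine unique (S := S) (p := p) ⟨Measure.isProbabilityMeasure_map hmeas.aemeasurable,
    fun s f => ?_⟩ h
  refine (Measure.map_apply hmeas (measurableSet_edgeCylinder s f)).trans ?_
  let φ : Γ × Fin d ≃ Γ × Fin d := (Equiv.mulLeft g).prodCongr (Equiv.refl _)
  have hset : (fun (ω : Γ × Fin d → Bool) (e : Γ × Fin d) => ω (g * e.1, e.2)) ⁻¹'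
      edgeCylinder s f = {ω | ∀ e ∈ s.map φ.toEmbedding, ω e = f (φ.symm e)} := by
    ext ω
    simp only [φ, edgeCylinder, mem_preimage, mem_ofPred_eq, Finset.mem_map_equiv]
    constructor
    · intro hω e he
      simpa using hω _ he
    · intro hω e he
      simpa using hω (g * e.1, e.2) (by simpa using he)
  rw [hset, h.2]
  simp

end IsBernoulli

section Measurability

variable {Ω X : Type} [MeasurableSpace Ω] [Countable X]

lemma measurableSet_reflTransGen {r : Ω → X → X → Prop}
    (hr : ∀ a b, MeasurableSet {ω | r ω a b}) (a b : X) :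
    MeasurableSet {ω | Relation.ReflTransGen (r ω) a b} := by
  let R : ℕ → X → Set Ω := fun n => n.rec (fun b => {_ω | a = b})
    fun _ A b => ⋃ c, A c ∩ {ω | r ω c b}
  have hR : ∀ n b, MeasurableSet (R n b) := by
    intro n
    induction n with
    | zero => exact fun b => MeasurableSet.const _
    | succ n ih => exact fun b => MeasurableSet.iUnion fun c => (ih c).inter (hr c b)
  have : {ω | Relation.ReflTransGen (r ω) a b} = ⋃ n, R n b := by
    ext ω
    simp only [mem_ofPred_eq, mem_iUnion]
    constructor
    · intro h
      induction h with
      | refl => exact ⟨0, rfl⟩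
      | tail _ h ih =>
        obtain ⟨n, hn⟩ := ih
        exact ⟨n + 1, mem_iUnion.2 ⟨_, hn, h⟩⟩
    · rintro ⟨n, hn⟩
      induction n generalizing b with
      | zero =>
        obtain rfl : a = b := hn
        exact .refl
      | succ n ih =>
        obtain ⟨c, hc, h⟩ := mem_iUnion.1 hn
        exact (ih c hc).tail h
  rw [this]
  exact MeasurableSet.iUnion fun n => hR n b

lemma measurableSet_infinite {C : Ω → Set X} (hC : ∀ x, MeasurableSet {ω | x ∈ C ω}) :
    MeasurableSet {ω | (C ω).Infinite} := by
  have : {ω | (C ω).Infinite} = ⋂ F : Finset X, ⋃ x : {x // x ∉ F}, {ω | x.1 ∈ C ω} := by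
    ext ω
    simp only [mem_ofPred_eq, mem_iInter, mem_iUnion]
    constructor
    · intro h F
      obtain ⟨x, hx, hxF⟩ := h.exists_notMem_finset F
      exact ⟨⟨x, hxF⟩, hx⟩
    · intro h hfin
      obtain ⟨⟨x, hxF⟩, hx⟩ := h hfin.toFinset
      exact hxF (hfin.mem_toFinset.2 hx)
  rw [this]
  exact MeasurableSet.iInter fun F => MeasurableSet.iUnion fun x => hC x

end Measurability

lemma measurableSet_openConn [Countable Γ] (S : Fin d → Γ) (u v : Γ) :
    MeasurableSet {ω | OpenConn S ω u v} := by
  refine measurableSet_reflTransGen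
    (r := fun (ω : Γ × Fin d → Bool) a b => ∃ e, ω e = true ∧ Joins S e a b)
    (fun a b => ?_) u v
  have : {ω : Γ × Fin d → Bool | ∃ e, ω e = true ∧ Joins S e a b}
      = ⋃ e, {ω | ω e = true} ∩ {_ω | Joins S e a b} := by
    ext; simp
  rw [this]
  exact MeasurableSet.iUnion fun e => (measurableSet_edge e _).inter (MeasurableSet.const _)

/-- The vertices reached from `C` along open oriented edges `g → g * S i` outside `Q`. -/
def outReach (S : Fin d → Γ) (ω : Γ × Fin d → Bool) (Q : Finset (Γ × Fin d)) (C : Finset Γ) :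
    Set Γ :=
  {v | ∃ u ∈ C, Relation.ReflTransGen
    (fun a b => ∃ i, (a, i) ∉ Q ∧ ω (a, i) = true ∧ b = a * S i) u v}

lemma subset_outReach (S : Fin d → Γ) (ω : Γ × Fin d → Bool) (Q : Finset (Γ × Fin d))
    (C : Finset Γ) : ↑C ⊆ outReach S ω Q C :=
  fun u hu => ⟨u, hu, .refl⟩

lemma outReach_subset_iUnion_cluster (S : Fin d → Γ) (ω : Γ × Fin d → Bool)
    (Q : Finset (Γ × Fin d)) (C : Finset Γ) :
    outReach S ω Q C ⊆ ⋃ u ∈ C, Cluster S ω u := by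
  rintro v ⟨u, hu, huv⟩
  refine mem_biUnion hu (Relation.ReflTransGen.mono ?_ _ _ huv)
  rintro a _ ⟨i, -, hi, rfl⟩
  exact ⟨(a, i), hi, Or.inl ⟨rfl, rfl⟩⟩

lemma measurableSet_mem_outReach [Countable Γ] (S : Fin d → Γ) (Q : Finset (Γ × Fin d))
    (C : Finset Γ) (v : Γ) : MeasurableSet {ω | v ∈ outReach S ω Q C} := by
  have : {ω | v ∈ outReach S ω Q C} = ⋃ u ∈ C, {ω | Relation.ReflTransGen
      (fun a b => ∃ i, (a, i) ∉ Q ∧ ω (a, i) = true ∧ b = a * S i) u v} := by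
    ext; simp [outReach]
  rw [this]
  refine Finset.measurableSet_biUnion _ fun u _ => measurableSet_reflTransGen
    (r := fun (ω : Γ × Fin d → Bool) a b => ∃ i, (a, i) ∉ Q ∧ ω (a, i) = true ∧ b = a * S i)
    (fun a b => ?_) u v
  have : {ω : Γ × Fin d → Bool | ∃ i, (a, i) ∉ Q ∧ ω (a, i) = true ∧ b = a * S i}
      = ⋃ i, {_ω | (a, i) ∉ Q} ∩ ({ω | ω (a, i) = true} ∩ {_ω | b = a * S i}) := by
    ext; simp
  rw [this]
  exact MeasurableSet.iUnion fun i => (MeasurableSet.const _).inter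
    ((measurableSet_edge _ _).inter (MeasurableSet.const _))

lemma outReach_insert_subset [DecidableEq Γ] (S : Fin d → Γ) (ω : Γ × Fin d → Bool)
    (Q : Finset (Γ × Fin d)) (C : Finset Γ) (e : Γ × Fin d) (b : Bool) :
    outReach S ω (insert e Q) C ⊆ outReach S (Function.update ω e b) Q C := by
  rintro v ⟨u, hu, huv⟩
  refine ⟨u, hu, Relation.ReflTransGen.mono ?_ _ _ huv⟩
  rintro a _ ⟨i, hi, hω, rfl⟩
  rw [Finset.mem_insert, not_or] at hi
  exact ⟨i, hi.2, by rwa [Function.update_of_ne hi.1], rfl⟩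

lemma outReach_insert_insert_subset [DecidableEq Γ] (S : Fin d → Γ) (ω : Γ × Fin d → Bool)
    (Q : Finset (Γ × Fin d)) (C : Finset Γ) {e : Γ × Fin d} (heC : e.1 ∈ C) (heQ : e ∉ Q) :
    outReach S ω (insert e Q) (insert (e.1 * S e.2) C) ⊆
      outReach S (Function.update ω e true) Q C := by
  rintro v ⟨u, hu, huv⟩
  obtain ⟨u', hu', h⟩ : v ∈ outReach S (Function.update ω e true) Q (insert (e.1 * S e.2) C) :=
    outReach_insert_subset _ _ _ _ _ _ ⟨u, hu, huv⟩
  rcases Finset.mem_insert.1 hu' with rfl | hu'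
  · exact ⟨e.1, heC, h.head ⟨e.2, heQ, Function.update_self _ _ _, rfl⟩⟩
  · exact ⟨u', hu', h⟩

/-- The oriented edges leaving `C`. -/
def outBoundary [DecidableEq Γ] (S : Fin d → Γ) (C : Finset Γ) : Finset (Γ × Fin d) :=
  (C ×ˢ Finset.univ).filter fun e => e.1 * S e.2 ∉ C

lemma mem_outBoundary [DecidableEq Γ] {S : Fin d → Γ} {C : Finset Γ} {e : Γ × Fin d} :
    e ∈ outBoundary S C ↔ e.1 ∈ C ∧ e.1 * S e.2 ∉ C := by
  simp [outBoundary]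

/-- The event that `outReach S ω Q C` has at most `n` elements. -/
def outReachLE (S : Fin d → Γ) (n : ℕ) (Q : Finset (Γ × Fin d)) (C : Finset Γ) :
    Set (Γ × Fin d → Bool) :=
  {ω | ∀ F : Finset Γ, ↑F ⊆ outReach S ω Q C → F.card ≤ n}

lemma measurableSet_outReachLE [Countable Γ] (S : Fin d → Γ) (n : ℕ) (Q : Finset (Γ × Fin d))
    (C : Finset Γ) : MeasurableSet (outReachLE S n Q C) := by
  have : outReachLE S n Q C =
      ⋂ F : Finset Γ, (⋂ v ∈ F, {ω | v ∈ outReach S ω Q C})ᶜ ∪ {_ω | F.card ≤ n} := by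
    ext ω
    simp [outReachLE, subset_def, imp_iff_not_or]
  rw [this]
  exact MeasurableSet.iInter fun F => (Finset.measurableSet_biInter _ fun v _ =>
    measurableSet_mem_outReach S Q C v).compl.union (MeasurableSet.const _)

/-- If every finite vertex set has a large boundary, then the exploration from `C` stops
with probability at most `2⁻ᶜ`, where `c` is the number of elements of `C`. -/
lemma IsBernoulli.measureReal_outReachLE_le [Countable Γ] [DecidableEq Γ] {S : Fin d → Γ} {p : ℝ}
    {P : Measure (Γ × Fin d → Bool)} (h : IsBernoulli S p P) (hp : p ∈ Icc (0 : ℝ) 1) {b : ℝ}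
    (hb : 1 ≤ b) (hpb : p / 2 + (1 - p) * b ≤ 1)
    (hS : ∀ C : Finset Γ, 2 ^ C.card ≤ b ^ (outBoundary S C).card)
    (n N : ℕ) (C : Finset Γ) (Q : Finset (Γ × Fin d)) (hQ : Q ⊆ C ×ˢ Finset.univ)
    (hN : n * d + 1 ≤ Q.card + N) :
    P.real (outReachLE S n Q C) ≤ (1 / 2) ^ C.card * b ^ (Q ∩ outBoundary S C).card := by
  have := h.1
  have hb0 : 0 ≤ b := by linarith
  induction N generalizing C Q with
  | zero =>
    have hlt : n < C.card := by
      by_contra hcon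
      have h1 := Finset.card_le_card hQ
      rw [Finset.card_product, Finset.card_univ, Fintype.card_fin] at h1
      have h2 := Nat.mul_le_mul_right d (not_lt.1 hcon)
      omega
    have : outReachLE S n Q C = ∅ := by
      refine eq_empty_of_forall_notMem fun ω hω => ?_
      exact absurd (hω C (subset_outReach S ω Q C)) (not_le.2 hlt)
    rw [this, measureReal_empty]
    positivity
  | succ N ih =>
    by_cases hsub : outBoundary S C ⊆ Q
    · rw [Finset.inter_eq_right.2 hsub]
      refine measureReal_le_one.trans ?_
      calc (1 : ℝ) = (1 / 2) ^ C.card * 2 ^ C.card := by rw [← mul_pow]; norm_num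
        _ ≤ _ := by gcongr; exact hS C
    · obtain ⟨e, heB, heQ⟩ := Finset.not_subset.1 hsub
      obtain ⟨heC, hev⟩ := mem_outBoundary.1 heB
      have hins : ∀ C', C ⊆ C' → insert e Q ⊆ C' ×ˢ Finset.univ := by
        intro C' hC'
        refine Finset.insert_subset (by simpa using hC' heC) (hQ.trans ?_)
        gcongr
      have hcard : n * d + 1 ≤ (insert e Q).card + N := by
        rw [Finset.card_insert_of_notMem heQ]; omega
      have h1 := ih (insert (e.1 * S e.2) C) (insert e Q) (hins _ (Finset.subset_insert _ _)) hcard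
      have h2 := ih C (insert e Q) (hins _ subset_rfl) hcard
      have h3 : insert e Q ∩ outBoundary S (insert (e.1 * S e.2) C) ⊆ Q ∩ outBoundary S C := by
        intro x hx
        obtain ⟨hx1, hx2⟩ := Finset.mem_inter.1 hx
        obtain ⟨-, hx3⟩ := mem_outBoundary.1 hx2
        rw [Finset.mem_insert, not_or] at hx3
        rcases Finset.mem_insert.1 hx1 with rfl | hxQ
        · exact absurd rfl hx3.1
        · exact Finset.mem_inter.2 ⟨hxQ, mem_outBoundary.2
            ⟨(Finset.mem_product.1 (hQ hxQ)).1, hx3.2⟩⟩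
      have h4 : (insert e Q ∩ outBoundary S C).card = (Q ∩ outBoundary S C).card + 1 := by
        rw [Finset.insert_inter_of_mem heB, Finset.card_insert_of_notMem
          fun hcon => heQ (Finset.mem_inter.1 hcon).1]
      have h5 : P.real {ω | Function.update ω e true ∈ outReachLE S n Q C} ≤
          (1 / 2) ^ (C.card + 1) * b ^ (Q ∩ outBoundary S C).card := by
        rw [← Finset.card_insert_of_notMem hev]
        have hsub' : {ω | Function.update ω e true ∈ outReachLE S n Q C} ⊆
            outReachLE S n (insert e Q) (insert (e.1 * S e.2) C) := fun ω hω F hF =>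
          hω F (hF.trans (outReach_insert_insert_subset S ω Q C heC heQ))
        refine (measureReal_mono hsub').trans (h1.trans ?_)
        gcongr
      have h6 : P.real {ω | Function.update ω e false ∈ outReachLE S n Q C} ≤
          (1 / 2) ^ C.card * b ^ ((Q ∩ outBoundary S C).card + 1) := by
        rw [← h4]
        have hsub' : {ω | Function.update ω e false ∈ outReachLE S n Q C} ⊆
            outReachLE S n (insert e Q) C := fun ω hω F hF =>
          hω F (hF.trans (outReach_insert_subset S ω Q C e false))
        exact (measureReal_mono hsub').trans h2
      rw [h.measureReal_eq_update hp e (measurableSet_outReachLE S n Q C)]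
      calc _ ≤ p * ((1 / 2) ^ (C.card + 1) * b ^ (Q ∩ outBoundary S C).card)
            + (1 - p) * ((1 / 2) ^ C.card * b ^ ((Q ∩ outBoundary S C).card + 1)) :=
          add_le_add (mul_le_mul_of_nonneg_left h5 hp.1)
            (mul_le_mul_of_nonneg_left h6 (by linarith [hp.2]))
        _ = (p / 2 + (1 - p) * b) * ((1 / 2) ^ C.card * b ^ (Q ∩ outBoundary S C).card) := by ring
        _ ≤ 1 * ((1 / 2) ^ C.card * b ^ (Q ∩ outBoundary S C).card) := by gcongr
        _ = _ := one_mul _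

lemma IsBernoulli.measure_percEvent_eq_one [Countable Γ] [Infinite Γ] {S : Fin d → Γ} {p : ℝ}
    {P : Measure (Γ × Fin d → Bool)} (h : IsBernoulli S p P) (hp : p ∈ Icc (0 : ℝ) 1) {b : ℝ}
    (hb : 1 ≤ b) (hpb : p / 2 + (1 - p) * b ≤ 1)
    (hS : ∀ [DecidableEq Γ] (C : Finset Γ), 2 ^ C.card ≤ b ^ (outBoundary S C).card) :
    P (PercEvent S) = 1 := by
  classical
  have := h.1
  have hle : ∀ C : Finset Γ, P (PercEvent S)ᶜ ≤ ENNReal.ofReal ((1 / 2) ^ C.card) := by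
    intro C
    have hsub : (PercEvent S)ᶜ ⊆ ⋃ n, outReachLE S n ∅ C := by
      intro ω hω
      have hfin : (outReach S ω ∅ C).Finite := by
        refine (C.finite_toSet.biUnion fun u _ => ?_).subset
          (outReach_subset_iUnion_cluster S ω ∅ C)
        by_contra hu
        exact hω ⟨u, hu⟩
      refine mem_iUnion.2 ⟨hfin.toFinset.card, fun F hF => Finset.card_le_card fun x hx => ?_⟩
      exact hfin.mem_toFinset.2 (hF hx)
    have hmono : Monotone fun n => outReachLE S n ∅ C :=
      fun n m hnm ω hω F hF => (hω F hF).trans hnm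
    refine (measure_mono hsub).trans ?_
    rw [hmono.measure_iUnion]
    refine iSup_le fun n => ?_
    rw [← ofReal_measureReal]
    refine ENNReal.ofReal_le_ofReal ?_
    simpa using h.measureReal_outReachLE_le hp hb hpb hS n (n * d + 1) C ∅ (by simp) (by simp)
  have hzero : P (PercEvent S)ᶜ = 0 := by
    have hlim : Filter.Tendsto (fun n : ℕ => ENNReal.ofReal ((1 / 2) ^ n)) Filter.atTop
        (nhds 0) := by
      rw [← ENNReal.ofReal_zero]
      exact ENNReal.tendsto_ofReal
        (tendsto_pow_atTop_nhds_zero_of_lt_one (by norm_num) (by norm_num))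
    refine le_antisymm (ge_of_tendsto' hlim fun n => ?_) zero_le
    obtain ⟨C, rfl⟩ := Infinite.exists_subset_card_eq Γ n
    exact hle C
  have : PercEvent S =ᵐ[P] univ := by
    rw [ae_eq_univ]
    exact hzero
  rw [measure_congr this, measure_univ]

/-- The indicator function of a finite set. -/
def finsetIndicator {X : Type} [DecidableEq X] (C : Finset X) : SquareSummable X :=
  ⟨fun g => if g ∈ C then 1 else 0, memℓp_two_of_summable_sq
    (summable_of_ne_finset_zero (s := C) fun g hg => by simp [hg])⟩

lemma finsetIndicator_apply {X : Type} [DecidableEq X] (C : Finset X) (g : X) :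
    finsetIndicator C g = if g ∈ C then 1 else 0 := rfl

lemma norm_finsetIndicator_sq {X : Type} [DecidableEq X] (C : Finset X) :
    ‖finsetIndicator C‖ ^ 2 = C.card := by
  rw [← (hasSum_sq (finsetIndicator C)).tsum_eq, tsum_eq_sum (s := C)
    fun g hg => by simp [finsetIndicator_apply, hg]]
  rw [Finset.sum_congr rfl fun g hg => by
    rw [finsetIndicator_apply, if_pos hg, one_pow]]
  simp

lemma inner_finsetIndicator {X : Type} [DecidableEq X] (C : Finset X) (f : SquareSummable X) :
    inner ℝ (finsetIndicator C) f = ∑ g ∈ C, f g := by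
  rw [lp.inner_eq_tsum, tsum_eq_sum (s := C) fun g hg => by simp [finsetIndicator_apply, hg]]
  exact Finset.sum_congr rfl fun g hg => by simp [finsetIndicator_apply, hg]

lemma NormSumLE.le_card_outBoundary [DecidableEq Γ] {S : Fin d → Γ} {q : ℝ} (h : NormSumLE S q)
    (C : Finset Γ) : (d - q) * C.card ≤ (outBoundary S C).card := by
  have h1 : ((outBoundary S C).card : ℝ) +
      ((C ×ˢ Finset.univ).filter fun e : Γ × Fin d => e.1 * S e.2 ∈ C).card = C.card * d := by
    rw [outBoundary, add_comm]
    exact_mod_cast (Finset.card_filter_add_card_filter_not _).trans (by simp)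
  have h2 : (((C ×ˢ Finset.univ).filter fun e : Γ × Fin d => e.1 * S e.2 ∈ C).card : ℝ) =
      inner ℝ (finsetIndicator C) (∑ i, rightReg (S i) (finsetIndicator C)) := by
    rw [inner_sum, Finset.card_filter, Finset.sum_product_right]
    push_cast
    refine Finset.sum_congr rfl fun i _ => ?_
    rw [inner_finsetIndicator]
    rfl
  have h3 : inner ℝ (finsetIndicator C) (∑ i, rightReg (S i) (finsetIndicator C))
      ≤ q * C.card := by
    refine (real_inner_le_norm _ _).trans ?_
    calc _ ≤ ‖finsetIndicator C‖ * (q * ‖finsetIndicator C‖) := by gcongr; exact h _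
      _ = _ := by rw [← norm_finsetIndicator_sq]; ring
  linarith

lemma NormSumLE.infinite {S : Fin d → Γ} {q : ℝ} (h : NormSumLE S q) (hq : q < d) :
    Infinite Γ := by
  classical
  by_contra hfin
  have := not_infinite_iff_finite.1 hfin
  have := Fintype.ofFinite Γ
  have h1 := h.le_card_outBoundary Finset.univ
  have h2 : outBoundary S Finset.univ = ∅ := by simp [outBoundary]
  have h3 : (0 : ℝ) < (Finset.univ : Finset Γ).card :=
    Nat.cast_pos.2 (Finset.card_pos.2 Finset.univ_nonempty)
  rw [h2, Finset.card_empty] at h1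
  have := mul_pos (sub_pos.2 hq) h3
  simp only [Nat.cast_zero] at h1
  linarith

lemma NormSumLE.pc_le [Countable Γ] {S : Fin d → Γ} {q : ℝ} (h : NormSumLE S q)
    (hq : 2 * q ≤ d) (hd : 6 ≤ d) : pc S ≤ 6 / d := by
  have hd' : (6 : ℝ) ≤ d := by exact_mod_cast hd
  have hd0 : (0 : ℝ) < d := by linarith
  have := h.infinite (by linarith)
  have hp : (6 / d : ℝ) ∈ Icc (0 : ℝ) 1 := ⟨by positivity, (div_le_one hd0).2 hd'⟩
  refine csInf_le ⟨0, fun x hx => hx.1.1⟩ ⟨hp, fun P hP => ?_⟩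
  have hb : (1 : ℝ) ≤ 1 + 3 / d := le_add_of_nonneg_right (by positivity)
  refine hP.measure_percEvent_eq_one hp hb ?_ fun C => ?_
  · have : (6 / d / 2 : ℝ) = 3 / d := by ring
    have h0 : (0 : ℝ) ≤ 3 / d := by positivity
    have h2 : (6 / d : ℝ) = 2 * (3 / d) := by ring
    rw [this, h2]
    nlinarith
  · have h4 : (4 : ℝ) ≤ (1 + 3 / d) ^ d := by
      refine le_trans ?_ (one_add_mul_le_pow (a := (3 / d : ℝ))
        (by linarith [show (0 : ℝ) ≤ 3 / d by positivity]) d)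
      field_simp
      norm_num
    have hcard : d * C.card ≤ 2 * (outBoundary S C).card := by
      have h5 := h.le_card_outBoundary C
      have h6 : (d : ℝ) * C.card ≤ 2 * (outBoundary S C).card := by
        have : (0 : ℝ) ≤ C.card := Nat.cast_nonneg _
        nlinarith
      exact_mod_cast h6
    refine (pow_le_pow_iff_left₀ (by positivity) (by positivity) two_ne_zero).1 ?_
    calc ((2 : ℝ) ^ C.card) ^ 2 = 4 ^ C.card := by rw [← pow_mul, mul_comm, pow_mul]; norm_num
      _ ≤ ((1 + 3 / d) ^ d) ^ C.card := by gcongr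
      _ = (1 + 3 / d) ^ (d * C.card) := by rw [pow_mul]
      _ ≤ (1 + 3 / d) ^ (2 * (outBoundary S C).card) := by gcongr
      _ = _ := by rw [mul_comm, pow_mul]

/-- The adjacency operator of the Cayley graph on `ℓ²(Γ)`. -/
def adjOp (S : Fin d → Γ) (f : SquareSummable Γ) : SquareSummable Γ :=
  ∑ i, rightReg (S i) f + ∑ i, rightReg (S i)⁻¹ f

/-- The function counting the walks of length `n` ending at `v`. -/
def walkCount [DecidableEq Γ] (S : Fin d → Γ) (n : ℕ) (v : Γ) : SquareSummable Γ :=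
  (adjOp S)^[n] (finsetIndicator {v})

lemma walkCount_succ_apply [DecidableEq Γ] (S : Fin d → Γ) (n : ℕ) (u v : Γ) :
    walkCount S (n + 1) v u = ∑ i, walkCount S n v (u * S i) +
      ∑ i, walkCount S n v (u * (S i)⁻¹) := by
  rw [walkCount, Function.iterate_succ_apply', ← walkCount, adjOp, lp.coeFn_add, Pi.add_apply,
    lp.coeFn_sum, lp.coeFn_sum, Finset.sum_apply, Finset.sum_apply]
  rfl

lemma walkCount_nonneg [DecidableEq Γ] (S : Fin d → Γ) (n : ℕ) (u v : Γ) :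
    0 ≤ walkCount S n v u := by
  induction n generalizing u with
  | zero =>
    change 0 ≤ finsetIndicator {v} u
    rw [finsetIndicator_apply]
    positivity
  | succ n ih =>
    rw [walkCount_succ_apply]
    exact add_nonneg (Finset.sum_nonneg fun i _ => ih _) (Finset.sum_nonneg fun i _ => ih _)

lemma NormSumLE.norm_walkCount_le [DecidableEq Γ] {S : Fin d → Γ} {q : ℝ} (h : NormSumLE S q)
    (hq : 0 ≤ q) (n : ℕ) (v : Γ) : ‖walkCount S n v‖ ≤ (2 * q) ^ n := by
  induction n with
  | zero =>
    change ‖finsetIndicator {v}‖ ≤ _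
    have := norm_finsetIndicator_sq {v}
    rw [Finset.card_singleton, Nat.cast_one] at this
    rw [pow_eq_one_iff_of_nonneg (norm_nonneg _) two_ne_zero] at this
    simp [this]
  | succ n ih =>
    rw [walkCount, Function.iterate_succ_apply', ← walkCount, adjOp, pow_succ]
    calc _ ≤ q * ‖walkCount S n v‖ + q * ‖walkCount S n v‖ :=
          (norm_add_le _ _).trans (add_le_add (h _) (h.inv _))
      _ = ‖walkCount S n v‖ * (2 * q) := by ring
      _ ≤ _ := by gcongr

lemma tendsto_apply_cofinite {X : Type} (f : SquareSummable X) :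
    Filter.Tendsto (fun x => f x) Filter.cofinite (nhds 0) := by
  have := (hasSum_sq f).summable.tendsto_cofinite_zero.sqrt
  simp only [Real.sqrt_sq_eq_abs, Real.sqrt_zero] at this
  exact tendsto_zero_iff_abs_tendsto_zero _ |>.2 this

/-- The event that some open path of length `n` from `u` to `v` visits only distinct vertices
and, after its starting point, no vertex of `A`. -/
def pathEvent [DecidableEq Γ] (S : Fin d → Γ) : ℕ → Finset Γ → Γ → Γ → Set (Γ × Fin d → Bool)
  | 0, _, u, v => {_ω | u = v}
  | n + 1, A, u, v =>
    (⋃ i, {ω | ω (u, i) = true} ∩ ({_ω | u * S i ∉ insert u A} ∩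
      pathEvent S n (insert u A) (u * S i) v)) ∪
    ⋃ i, {ω | ω (u * (S i)⁻¹, i) = true} ∩ ({_ω | u * (S i)⁻¹ ∉ insert u A} ∩
      pathEvent S n (insert u A) (u * (S i)⁻¹) v)

lemma measurableSet_pathEvent [DecidableEq Γ] (S : Fin d → Γ) (n : ℕ) (A : Finset Γ) (u v : Γ) :
    MeasurableSet (pathEvent S n A u v) := by
  induction n generalizing A u with
  | zero => exact MeasurableSet.const _
  | succ n ih =>
    exact (MeasurableSet.iUnion fun i => (measurableSet_edge _ _).inter
      ((MeasurableSet.const _).inter (ih _ _))).union (MeasurableSet.iUnion fun i =>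
        (measurableSet_edge _ _).inter ((MeasurableSet.const _).inter (ih _ _)))

lemma mem_pathEvent_of_update [DecidableEq Γ] {S : Fin d → Γ} {n : ℕ} {A : Finset Γ} {u v : Γ}
    (hu : u ∉ A) {e : Γ × Fin d} (he : e.1 ∈ A ∨ e.1 * S e.2 ∈ A) {b : Bool}
    {ω : Γ × Fin d → Bool} (h : Function.update ω e b ∈ pathEvent S n A u v) :
    ω ∈ pathEvent S n A u v := by
  induction n generalizing A u with
  | zero => exact h
  | succ n ih =>
    have he' : e.1 ∈ insert u A ∨ e.1 * S e.2 ∈ insert u A :=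
      he.imp (Finset.mem_insert_of_mem ·) (Finset.mem_insert_of_mem ·)
    rcases h with h | h
    · obtain ⟨i, h1, h2, h3⟩ := mem_iUnion.1 h
      refine Or.inl (mem_iUnion.2 ⟨i, ?_, h2, ih h2 he' h3⟩)
      have hne : (u, i) ≠ e := by
        rintro rfl
        exact h2 (Finset.mem_insert_of_mem (he.resolve_left hu))
      rwa [mem_ofPred_eq, Function.update_of_ne hne] at h1
    · obtain ⟨i, h1, h2, h3⟩ := mem_iUnion.1 h
      refine Or.inr (mem_iUnion.2 ⟨i, ?_, h2, ih h2 he' h3⟩)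
      have hne : (u * (S i)⁻¹, i) ≠ e := by
        rintro rfl
        rcases he with he | he
        · exact h2 (Finset.mem_insert_of_mem he)
        · exact hu (by simpa using he)
      rwa [mem_ofPred_eq, Function.update_of_ne hne] at h1

lemma IsBernoulli.measureReal_edge_inter_pathEvent_le [DecidableEq Γ] {S : Fin d → Γ} {p : ℝ}
    {P : Measure (Γ × Fin d → Bool)} (h : IsBernoulli S p P) (hp : p ∈ Icc (0 : ℝ) 1)
    {n : ℕ} {A : Finset Γ} {u v : Γ} {e : Γ × Fin d} (he : e.1 ∈ A ∨ e.1 * S e.2 ∈ A) :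
    P.real ({ω | ω e = true} ∩ ({_ω | u ∉ A} ∩ pathEvent S n A u v)) ≤
      p * P.real ({_ω | u ∉ A} ∩ pathEvent S n A u v) := by
  have := h.1
  by_cases hu : u ∈ A
  · simp [hu]
  have hset : ({_ω | u ∉ A} ∩ pathEvent S n A u v : Set _) = pathEvent S n A u v := by
    simp [hu]
  rw [hset, h.measureReal_eq_update hp e
    ((measurableSet_edge e true).inter (measurableSet_pathEvent S n A u v))]
  have h1 : {ω | Function.update ω e false ∈ {ω | ω e = true} ∩ pathEvent S n A u v} = ∅ := by
    ext ω; simp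
  rw [h1, measureReal_empty, mul_zero, add_zero]
  have h2 : {ω | Function.update ω e true ∈ {ω | ω e = true} ∩ pathEvent S n A u v} ⊆
      pathEvent S n A u v := fun ω hω => mem_pathEvent_of_update hu he hω.2
  exact mul_le_mul_of_nonneg_left (measureReal_mono h2) hp.1

lemma IsBernoulli.measureReal_pathEvent_le [DecidableEq Γ] {S : Fin d → Γ} {p : ℝ}
    {P : Measure (Γ × Fin d → Bool)} (h : IsBernoulli S p P) (hp : p ∈ Icc (0 : ℝ) 1)
    (n : ℕ) (A : Finset Γ) (u v : Γ) :
    P.real (pathEvent S n A u v) ≤ p ^ n * walkCount S n v u := by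
  have := h.1
  have hp0 := hp.1
  induction n generalizing A u with
  | zero =>
    change P.real {_ω | u = v} ≤ p ^ 0 * finsetIndicator {v} u
    rw [finsetIndicator_apply]
    by_cases huv : u = v <;> simp [huv]
  | succ n ih =>
    have key : ∀ (w : Γ) (e : Γ × Fin d), (e.1 ∈ insert u A ∨ e.1 * S e.2 ∈ insert u A) →
        P.real ({ω | ω e = true} ∩ ({_ω | w ∉ insert u A} ∩ pathEvent S n (insert u A) w v)) ≤
          p ^ (n + 1) * walkCount S n v w := by
      intro w e he
      refine (h.measureReal_edge_inter_pathEvent_le hp he).trans ?_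
      rw [pow_succ', mul_assoc]
      exact mul_le_mul_of_nonneg_left
        ((measureReal_mono inter_subset_right).trans (ih _ _)) hp0
    rw [walkCount_succ_apply, mul_add, Finset.mul_sum, Finset.mul_sum, pathEvent]
    refine (measureReal_union_le _ _).trans (add_le_add ?_ ?_)
    · refine (measureReal_iUnion_fintype_le _).trans (Finset.sum_le_sum fun i _ => ?_)
      exact key _ _ (Or.inl (by simp))
    · refine (measureReal_iUnion_fintype_le _).trans (Finset.sum_le_sum fun i _ => ?_)
      exact key _ _ (Or.inr (by simp))

/-- The simple graph of the open edges. -/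
def openGraph (S : Fin d → Γ) (ω : Γ × Fin d → Bool) : SimpleGraph Γ :=
  SimpleGraph.fromRel fun a b => ∃ e, ω e = true ∧ Joins S e a b

lemma Joins.symm {S : Fin d → Γ} {e : Γ × Fin d} {u v : Γ} (h : Joins S e u v) :
    Joins S e v u := Or.symm h

lemma openGraph_adj {S : Fin d → Γ} {ω : Γ × Fin d → Bool} {a b : Γ} :
    (openGraph S ω).Adj a b ↔ a ≠ b ∧ ∃ e, ω e = true ∧ Joins S e a b := by
  rw [openGraph, SimpleGraph.fromRel_adj]
  refine and_congr_right fun _ => or_iff_left_of_imp ?_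
  rintro ⟨e, he, h⟩
  exact ⟨e, he, h.symm⟩

lemma OpenConn.reachable {S : Fin d → Γ} {ω : Γ × Fin d → Bool} {u v : Γ}
    (h : OpenConn S ω u v) : (openGraph S ω).Reachable u v := by
  induction h with
  | refl => exact .refl u
  | @tail b c _ h ih =>
    by_cases hbc : b = c
    · exact hbc ▸ ih
    · exact ih.trans (openGraph_adj.2 ⟨hbc, h⟩).reachable

lemma mem_pathEvent_of_isPath [DecidableEq Γ] {S : Fin d → Γ} {ω : Γ × Fin d → Bool} {u v : Γ}
    (w : (openGraph S ω).Walk u v) (hw : w.IsPath) (A : Finset Γ)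
    (hA : ∀ x ∈ w.support, x ∉ A) : ω ∈ pathEvent S w.length A u v := by
  induction w generalizing A with
  | nil => exact rfl
  | @cons u x v hadj w ih =>
    rw [SimpleGraph.Walk.cons_isPath_iff] at hw
    have hA' : ∀ y ∈ w.support, y ∉ insert u A := by
      intro y hy
      rw [Finset.mem_insert, not_or]
      exact ⟨fun h => hw.2 (h ▸ hy), hA y (List.mem_cons_of_mem _ hy)⟩
    have hx : x ∉ insert u A := hA' x w.start_mem_support
    obtain ⟨-, ⟨g, i⟩, he, hj⟩ := openGraph_adj.1 hadj
    rcases hj with ⟨h1, h2⟩ | ⟨h1, h2⟩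
    · dsimp only at h1 h2
      subst h1 h2
      exact Or.inl (mem_iUnion.2 ⟨i, he, hx, ih hw.1 _ hA'⟩)
    · dsimp only at h1 h2
      obtain rfl : x = u * (S i)⁻¹ := by rw [h1, h2]; simp
      subst h1
      exact Or.inr (mem_iUnion.2 ⟨i, he, hx, ih hw.1 _ hA'⟩)

lemma setOf_openConn_subset [DecidableEq Γ] (S : Fin d → Γ) (u v : Γ) :
    {ω | OpenConn S ω u v} ⊆ ⋃ n, pathEvent S n ∅ u v := by
  intro ω hω
  obtain ⟨w, hw⟩ := (OpenConn.reachable hω).exists_isPath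
  exact mem_iUnion.2 ⟨w.length, mem_pathEvent_of_isPath w hw ∅ (by simp)⟩

lemma OpenConn.symm {S : Fin d → Γ} {ω : Γ × Fin d → Bool} {u v : Γ} (h : OpenConn S ω u v) :
    OpenConn S ω v u := by
  induction h with
  | refl => exact .refl
  | tail _ h ih =>
    obtain ⟨e, he, hj⟩ := h
    exact Relation.ReflTransGen.head ⟨e, he, hj.symm⟩ ih

lemma OpenConn.trans {S : Fin d → Γ} {ω : Γ × Fin d → Bool} {u v w : Γ}
    (h : OpenConn S ω u v) (h' : OpenConn S ω v w) : OpenConn S ω u w :=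
  Relation.ReflTransGen.trans h h'

lemma NormSumLE.walkCount_term_le [DecidableEq Γ] {S : Fin d → Γ} {q p : ℝ} (h : NormSumLE S q)
    (hq : 0 ≤ q) (hp : 0 ≤ p) (hpq : 2 * q * p ≤ 1 / 2) (n : ℕ) (u v : Γ) :
    p ^ n * walkCount S n v u ≤ (1 / 2) ^ n := by
  calc p ^ n * walkCount S n v u ≤ p ^ n * (2 * q) ^ n := by
        gcongr
        exact (le_abs_self _).trans ((abs_apply_le_norm _ _).trans (h.norm_walkCount_le hq n v))
    _ = (2 * q * p) ^ n := by rw [← mul_pow, mul_comm]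
    _ ≤ _ := by gcongr

lemma summable_half_pow : Summable fun n : ℕ => (1 / 2 : ℝ) ^ n :=
  summable_geometric_of_lt_one (by norm_num) (by norm_num)

/-- The two-point function is bounded by the Green function at `p`. -/
lemma IsBernoulli.measureReal_openConn_le [DecidableEq Γ] {S : Fin d → Γ} {p q : ℝ}
    {P : Measure (Γ × Fin d → Bool)} (h : IsBernoulli S p P) (hp : p ∈ Icc (0 : ℝ) 1)
    (hS : NormSumLE S q) (hq : 0 ≤ q) (hpq : 2 * q * p ≤ 1 / 2) (u v : Γ) :
    P.real {ω | OpenConn S ω u v} ≤ ∑' n, p ^ n * walkCount S n v u := by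
  have := h.1
  have hnn : ∀ n, 0 ≤ p ^ n * walkCount S n v u := fun n =>
    mul_nonneg (pow_nonneg hp.1 n) (walkCount_nonneg S n u v)
  have hsum : Summable fun n => p ^ n * walkCount S n v u :=
    Summable.of_nonneg_of_le hnn (fun n => hS.walkCount_term_le hq hp.1 hpq n u v)
      summable_half_pow
  refine ENNReal.toReal_le_of_le_ofReal (tsum_nonneg hnn) ?_
  rw [ENNReal.ofReal_tsum_of_nonneg hnn hsum]
  refine (measure_mono (setOf_openConn_subset S u v)).trans ((measure_iUnion_le _).trans ?_)
  refine ENNReal.tsum_le_tsum fun n => ?_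
  rw [← ofReal_measureReal]
  exact ENNReal.ofReal_le_ofReal (h.measureReal_pathEvent_le hp n ∅ u v)

lemma IsBernoulli.tendsto_measureReal_openConn {S : Fin d → Γ} {p q : ℝ}
    {P : Measure (Γ × Fin d → Bool)} (h : IsBernoulli S p P) (hp : p ∈ Icc (0 : ℝ) 1)
    (hS : NormSumLE S q) (hq : 0 ≤ q) (hpq : 2 * q * p ≤ 1 / 2) (v : Γ) :
    Filter.Tendsto (fun u => P.real {ω | OpenConn S ω u v}) Filter.cofinite (nhds 0) := by
  classical
  refine squeeze_zero (fun u => measureReal_nonneg)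
    (fun u => h.measureReal_openConn_le hp hS hq hpq u v) ?_
  rw [← tsum_zero (α := ℝ) (β := ℕ)]
  refine tendsto_tsum_of_dominated_convergence summable_half_pow (fun n => ?_)
    (Filter.Eventually.of_forall fun u n => ?_)
  · simpa using (tendsto_apply_cofinite (walkCount S n v)).const_mul (p ^ n)
  · rw [Real.norm_of_nonneg (mul_nonneg (pow_nonneg hp.1 n) (walkCount_nonneg S n u v))]
    exact hS.walkCount_term_le hq hp.1 hpq n u v

/-- The event that some vertex of `K` lies in an infinite cluster. -/
def meetsInfinite (S : Fin d → Γ) (K : Set Γ) : Set (Γ × Fin d → Bool) :=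
  {ω | ∃ v ∈ K, (Cluster S ω v).Infinite}

lemma measurableSet_meetsInfinite [Countable Γ] (S : Fin d → Γ) (K : Set Γ) :
    MeasurableSet (meetsInfinite S K) := by
  have : meetsInfinite S K = ⋃ v ∈ K, {ω | (Cluster S ω v).Infinite} := by
    ext; simp [meetsInfinite]
  rw [this]
  exact MeasurableSet.biUnion K.to_countable fun v _ =>
    measurableSet_infinite fun x => measurableSet_openConn S v x

lemma openConn_translate {S : Fin d → Γ} {ω : Γ × Fin d → Bool} {g u v : Γ}
    (h : OpenConn S (fun e => ω (g * e.1, e.2)) u v) : OpenConn S ω (g * u) (g * v) := by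
  refine Relation.ReflTransGen.lift (g * ·) ?_ _ _ h
  rintro a b ⟨e, he, hj⟩
  refine ⟨(g * e.1, e.2), he, ?_⟩
  rcases hj with ⟨rfl, rfl⟩ | ⟨rfl, rfl⟩
  · exact Or.inl ⟨rfl, (mul_assoc _ _ _).symm⟩
  · exact Or.inr ⟨rfl, (mul_assoc _ _ _).symm⟩

lemma IsBernoulli.measureReal_meetsInfinite_le [Countable Γ] {S : Fin d → Γ} {p : ℝ}
    {P : Measure (Γ × Fin d → Bool)} (h : IsBernoulli S p P) (K : Set Γ) (g : Γ) :
    P.real (meetsInfinite S K) ≤ P.real (meetsInfinite S ((g * ·) '' K)) := by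
  have := h.1
  have hmeas : Measurable fun (ω : Γ × Fin d → Bool) (e : Γ × Fin d) => ω (g * e.1, e.2) :=
    measurable_pi_lambda _ fun e => measurable_pi_apply _
  conv_lhs => rw [← h.map_translate g]
  rw [map_measureReal_apply hmeas (measurableSet_meetsInfinite S K)]
  refine measureReal_mono ?_
  rintro ω ⟨v, hv, hinf⟩
  refine ⟨g * v, mem_image_of_mem _ hv, ?_⟩
  refine (hinf.image (mul_right_injective g).injOn).mono ?_
  rintro _ ⟨u, hu, rfl⟩
  exact openConn_translate hu

lemma openConn_of_mem_uniqueEvent {S : Fin d → Γ} {ω : Γ × Fin d → Bool} (h : ω ∈ UniqueEvent S)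
    {u v : Γ} (hu : (Cluster S ω u).Infinite) (hv : (Cluster S ω v).Infinite) :
    OpenConn S ω u v := by
  have : Cluster S ω u = Cluster S ω v := h.unique ⟨⟨u, rfl⟩, hu⟩ ⟨⟨v, rfl⟩, hv⟩
  have hmem : v ∈ Cluster S ω v := Relation.ReflTransGen.refl
  rwa [← this] at hmem

lemma exists_finset_lt_measureReal_meetsInfinite [Countable Γ] {S : Fin d → Γ}
    {P : Measure (Γ × Fin d → Bool)} [IsProbabilityMeasure P] (hP : P (UniqueEvent S) = 1)
    {c : ℝ} (hc : c < 1) : ∃ K : Finset Γ, c < P.real (meetsInfinite S K) := by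
  classical
  have hsub : UniqueEvent S ⊆ ⋃ K : Finset Γ, meetsInfinite S K := by
    rintro ω ⟨C, ⟨⟨v, rfl⟩, hC⟩, -⟩
    exact mem_iUnion.2 ⟨{v}, v, by simp, hC⟩
  have hdir : Directed (· ⊆ ·) fun K : Finset Γ => meetsInfinite S (K : Set Γ) :=
    Monotone.directed_le (f := fun K : Finset Γ => meetsInfinite S (K : Set Γ))
      fun K L hKL ω ⟨v, hv, hinf⟩ => ⟨v, hKL hv, hinf⟩
  have h1 : 1 ≤ ⨆ K : Finset Γ, P (meetsInfinite S K) := by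
    rw [← hdir.measure_iUnion, ← hP]
    exact measure_mono hsub
  have h2 : ENNReal.ofReal c < ⨆ K : Finset Γ, P (meetsInfinite S K) :=
    (ENNReal.ofReal_lt_one.2 hc).trans_le h1
  obtain ⟨K, hK⟩ := lt_iSup_iff.1 h2
  refine ⟨K, ?_⟩
  rw [← ofReal_measureReal] at hK
  exact (ENNReal.ofReal_lt_ofReal_iff'.1 hK).1

lemma IsBernoulli.measure_uniqueEvent_ne_one [Countable Γ] [Infinite Γ] {S : Fin d → Γ}
    {p q : ℝ} {P : Measure (Γ × Fin d → Bool)} (h : IsBernoulli S p P) (hp : p ∈ Icc (0 : ℝ) 1)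
    (hS : NormSumLE S q) (hq : 0 ≤ q) (hpq : 2 * q * p ≤ 1 / 2) : P (UniqueEvent S) ≠ 1 := by
  have := h.1
  intro hP
  obtain ⟨K, hK⟩ := exists_finset_lt_measureReal_meetsInfinite hP (c := 3 / 4) (by norm_num)
  have hlim : Filter.Tendsto (fun g => ∑ b ∈ K, ∑ a ∈ K, P.real {ω | OpenConn S ω (g * b) a})
      Filter.cofinite (nhds 0) := by
    have h0 : (0 : ℝ) = ∑ b ∈ K, ∑ a ∈ K, 0 := by simp
    rw [h0]
    exact tendsto_finsetSum _ fun b _ => tendsto_finsetSum _ fun a _ =>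
      (h.tendsto_measureReal_openConn hp hS hq hpq a).comp
        (mul_left_injective b).tendsto_cofinite
  obtain ⟨g, hg⟩ := (hlim.eventually (gt_mem_nhds (show (0 : ℝ) < 1 / 2 by norm_num))).exists
  refine absurd hg (not_lt.2 ?_)
  set A := meetsInfinite S (K : Set Γ)
  set B := meetsInfinite S ((g * ·) '' (K : Set Γ))
  have hA : MeasurableSet A := measurableSet_meetsInfinite S _
  have hB : MeasurableSet B := measurableSet_meetsInfinite S _
  have hKB : 3 / 4 < P.real B := hK.trans_le (h.measureReal_meetsInfinite_le K g)
  have h1 := measureReal_union_add_inter (μ := P) (s := A) hB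
  have h2 : P.real (A ∪ B) ≤ 1 := measureReal_le_one
  have h3 := measureReal_inter_add_sdiff (μ := P) (s := UniqueEvent S) (hA.inter hB)
  have h4 : P.real (UniqueEvent S) = 1 := by rw [measureReal_def, hP]; rfl
  have h5 : P.real (UniqueEvent S \ (A ∩ B)) ≤ P.real (A ∩ B)ᶜ :=
    measureReal_mono fun ω hω => hω.2
  have h6 := probReal_compl_eq_one_sub (μ := P) (hA.inter hB)
  have h7 : UniqueEvent S ∩ (A ∩ B) ⊆ ⋃ b ∈ K, ⋃ a ∈ K, {ω | OpenConn S ω (g * b) a} := by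
    rintro ω ⟨hω, ⟨a, ha, hinfa⟩, _, ⟨b, hb, rfl⟩, hinfb⟩
    exact mem_biUnion hb (mem_biUnion ha (openConn_of_mem_uniqueEvent hω hinfb hinfa))
  have h8 : P.real (UniqueEvent S ∩ (A ∩ B)) ≤
      ∑ b ∈ K, ∑ a ∈ K, P.real {ω | OpenConn S ω (g * b) a} :=
    (measureReal_mono h7 (measure_ne_top _ _)).trans ((measureReal_biUnion_finset_le _ _).trans
      (Finset.sum_le_sum fun b _ => measureReal_biUnion_finset_le _ _))
  linarith

lemma openConn_of_forall_open {S : Fin d → Γ} (hS : Subgroup.closure (range S) = ⊤)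
    {ω : Γ × Fin d → Bool} (hω : ∀ e, ω e = true) (u v : Γ) : OpenConn S ω u v := by
  have key : ∀ x ∈ Subgroup.closure (range S), ∀ u, OpenConn S ω u (u * x) := by
    intro x hx
    induction hx using Subgroup.closure_induction with
    | mem x hx =>
      obtain ⟨i, rfl⟩ := hx
      exact fun u => .single ⟨(u, i), hω _, Or.inl ⟨rfl, rfl⟩⟩
    | one => exact fun u => by rw [mul_one]; exact .refl
    | mul x y _ _ hx hy => exact fun u => (hx u).trans (by simpa [mul_assoc] using hy (u * x))
    | inv x _ hx => exact fun u => OpenConn.symm (by simpa using hx (u * x⁻¹))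
  simpa using key (u⁻¹ * v) (hS ▸ Subgroup.mem_top _) u

lemma IsBernoulli.measure_uniqueEvent_of_one [Countable Γ] [Infinite Γ] {S : Fin d → Γ}
    (hS : Subgroup.closure (range S) = ⊤) {P : Measure (Γ × Fin d → Bool)}
    (h : IsBernoulli S 1 P) : P (UniqueEvent S) = 1 := by
  have := h.1
  have hedge : ∀ e, ∀ᵐ ω ∂P, ω e = true := by
    intro e
    have h1 := h.2 {e} fun _ => true
    simp only [Finset.mem_singleton, forall_eq, Finset.prod_singleton, if_true,
      ENNReal.ofReal_one] at h1
    exact (prob_compl_eq_zero_iff (measurableSet_edge e true)).2 h1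
  have hall : UniqueEvent S =ᵐ[P] univ := by
    rw [Filter.eventuallyEq_univ]
    filter_upwards [ae_all_iff.2 hedge] with ω hω
    have huniv : ∀ v, Cluster S ω v = univ := fun v =>
      eq_univ_of_forall fun u => openConn_of_forall_open hS hω v u
    refine ⟨univ, ⟨⟨1, (huniv 1).symm⟩, infinite_univ⟩, ?_⟩
    rintro _ ⟨⟨v, rfl⟩, -⟩
    exact huniv v
  rw [measure_congr hall, measure_univ]

lemma NormSumLE.le_pu [Countable Γ] {S : Fin d → Γ} {q : ℝ} (h : NormSumLE S q)
    (hS : Subgroup.closure (range S) = ⊤) (hq : 0 ≤ q) (hqd : 28 * q ≤ d) (hd : 7 ≤ d) :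
    7 / d ≤ pu S := by
  have hd' : (7 : ℝ) ≤ d := by exact_mod_cast hd
  have hd0 : (0 : ℝ) < d := by linarith
  have := h.infinite (by linarith)
  refine le_csInf ⟨1, ⟨zero_le_one, le_rfl⟩, fun P hP => hP.measure_uniqueEvent_of_one hS⟩ ?_
  rintro p ⟨hp, hall⟩
  by_contra! hlt
  obtain ⟨P, hP⟩ := IsBernoulli.exists_of_mem_Icc S hp
  refine hP.measure_uniqueEvent_ne_one hp h hq ?_ (hall P hP)
  rw [lt_div_iff₀ hd0] at hlt
  nlinarith [mul_le_mul_of_nonneg_right hqd hp.1]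

lemma countable_of_closure_range_eq_top {n : ℕ} {T : Fin n → Γ}
    (hT : Subgroup.closure (range T) = ⊤) : Countable Γ :=
  (FreeGroup.lift_surjective_iff_closure_range_eq_top.2 hT).countable

/-- Pak–Smirnova-Nagnibeda: every finitely generated nonamenable group `Γ` has a finite
generating family `S` (repetitions allowed) whose Cayley graph has a nonuniqueness phase:
`p_c(Cay(Γ, S)) < p_u(Cay(Γ, S))`. -/
theorem exists_generating_family_pc_lt_pu (Γ : Type) [Group Γ]
    (hfg : ∃ (n : ℕ) (T : Fin n → Γ), Subgroup.closure (Set.range T) = ⊤)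
    (hna : ¬ IsAmenable Γ) :
    ∃ (d : ℕ) (S : Fin d → Γ), Subgroup.closure (Set.range S) = ⊤ ∧ pc S < pu S := by
  obtain ⟨n, T, hT⟩ := hfg
  have := countable_of_closure_range_eq_top hT
  obtain ⟨d, S, q, hS, hSq, hq0, hq, hd⟩ :=
    exists_generating_family_normSumLE ⟨n, T, hT⟩ hna (ε := 1 / 28) (by norm_num) 7
  have hd' : (7 : ℝ) ≤ d := by exact_mod_cast hd
  refine ⟨d, S, hS, ?_⟩
  calc pc S ≤ 6 / d := hSq.pc_le (by linarith) (by omega)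
    _ < 7 / d := by gcongr; norm_num
    _ ≤ pu S := hSq.le_pu hS hq0 (by linarith) hd

end
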